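/- Theorem 6.1: Suppose assumptions A1, A2, A3 hold. Then: (1) y_0 := C1·Φ1 + C2·Φ2 with C1 = ⟨Φ0, FΦ2⟩ and C2 = −⟨Φ0, FΦ1⟩ is a real nonzero linear combination of Φ1 and Φ2 with ‖y_0‖ = 1; (2) there exist real sequences (λ_n)_{n≥1}, (s_n)_{n≥1}, (γ_n)_{n≥1}; (3) for each n ≥ 1 there exists a real vector function y_n = y_n^{(p)} + γ_n·y0^⊥ solving −y_n'' + D0(x) y_n − λ0 y_n = g_n(x) on (0,∞) with y_n'(0) = 0 and y_n(x) → 0 as x → +∞, where g_n = Σ_{i=1}^{n} (λ_i − s_i D1(x)) y_{n−i} − F(x) y_{n−1}, y_n^{(p)} is a real particular solution satisfying ⟨Φ1, y_n^{(p)}⟩ = ⟨Φ2, y_n^{(p)}⟩ = 0, and y0^⊥ = C2·Φ1 − C1·Φ2. -/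

import Mathlib

open MeasureTheory Set Filter

noncomputable section

/-- `Sol1D d lam g y y'` : `y` (with derivative `y'`) is a C¹ solution on `[0,∞)`
of `-y'' + d(x) y - lam·y = g(x)`, the equation holding away from finitely many
points, with boundary condition `y'(0) = 0`. -/
def Sol1D (d : ℝ → ℝ) (lam : ℝ) (g : ℝ → ℝ) (y y' : ℝ → ℝ) : Prop :=
  (∀ x ∈ Set.Ici (0 : ℝ), HasDerivWithinAt y (y' x) (Set.Ici 0) x) ∧
  ContinuousOn y' (Set.Ici 0) ∧
  (∃ E : Finset ℝ, ∀ x ∈ Set.Ioi (0 : ℝ), x ∉ (E : Set ℝ) →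
    HasDerivAt y' (d x * y x - lam * y x - g x) x) ∧
  y' 0 = 0

/-- A bound state of `-d²/dx² + d(x)` on `(0,∞)` with Neumann condition at `0`. -/
def IsBoundState1D (d : ℝ → ℝ) (lam : ℝ) (y y' : ℝ → ℝ) : Prop :=
  Sol1D d lam (fun _ => 0) y y' ∧
  Filter.Tendsto y Filter.atTop (nhds 0) ∧
  ∃ x ∈ Set.Ici (0 : ℝ), y x ≠ 0

/-- `DiagBVPSol D lam g y y'` : solution of the uncoupled inhomogeneous system
`-y'' + diag(D) y - lam·y = g` on `(0,∞)` with `y'(0) = 0` and `y → 0` at `+∞`. -/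
def DiagBVPSol (D : ℝ → Fin 3 → ℝ) (lam : ℝ) (g : ℝ → Fin 3 → ℝ)
    (y y' : ℝ → Fin 3 → ℝ) : Prop :=
  (∀ x ∈ Set.Ici (0 : ℝ), HasDerivWithinAt y (y' x) (Set.Ici 0) x) ∧
  ContinuousOn y' (Set.Ici 0) ∧
  (∃ E : Finset ℝ, ∀ x ∈ Set.Ioi (0 : ℝ), x ∉ (E : Set ℝ) →
    HasDerivAt y' (fun i => D x i * y x i - lam * y x i - g x i) x) ∧
  y' 0 = 0 ∧
  Filter.Tendsto y Filter.atTop (nhds 0)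

/-- `f` is continuous on `(0,∞)` off a finite set and bounded on bounded subsets of `[0,∞)`. -/
def PWCont (f : ℝ → ℝ) : Prop :=
  (∃ E : Finset ℝ, ∀ x ∈ Ioi (0 : ℝ), x ∉ (E : Set ℝ) → ContinuousAt f x) ∧
  ∀ R, ∃ C, ∀ x ∈ Icc (0 : ℝ) R, |f x| ≤ C

/-- `f` decays at least as fast as `exp (-β x)` on `[0,∞)`. -/
def ExpDecay (β : ℝ) (f : ℝ → ℝ) : Prop :=
  ∃ C, ∀ x ∈ Ici (0 : ℝ), |f x| ≤ C * Real.exp (-β * x)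

namespace PWCont

lemma of_continuousOn {f : ℝ → ℝ} (hf : ContinuousOn f (Ici 0)) : PWCont f := by
  refine ⟨⟨∅, fun x hx _ => hf.continuousAt (Ici_mem_nhds hx)⟩, fun R => ?_⟩
  obtain ⟨C, hC⟩ := isCompact_Icc.exists_bound_of_continuousOn
    (hf.mono (Icc_subset_Ici_self : Icc 0 R ⊆ Ici 0))
  exact ⟨C, fun x hx => hC x hx⟩

lemma const (c : ℝ) : PWCont fun _ => c := of_continuousOn continuousOn_const

lemma add {f g : ℝ → ℝ} (hf : PWCont f) (hg : PWCont g) : PWCont fun x => f x + g x := by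
  obtain ⟨⟨E, hE⟩, hf⟩ := hf
  obtain ⟨⟨E', hE'⟩, hg⟩ := hg
  refine ⟨⟨E ∪ E', fun x hx hxE => ?_⟩, fun R => ?_⟩
  · simp only [Finset.coe_union, mem_union, not_or] at hxE
    exact (hE x hx hxE.1).add (hE' x hx hxE.2)
  · obtain ⟨C, hC⟩ := hf R
    obtain ⟨C', hC'⟩ := hg R
    exact ⟨C + C', fun x hx => (abs_add_le _ _).trans (add_le_add (hC x hx) (hC' x hx))⟩

lemma mul {f g : ℝ → ℝ} (hf : PWCont f) (hg : PWCont g) : PWCont fun x => f x * g x := by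
  obtain ⟨⟨E, hE⟩, hf⟩ := hf
  obtain ⟨⟨E', hE'⟩, hg⟩ := hg
  refine ⟨⟨E ∪ E', fun x hx hxE => ?_⟩, fun R => ?_⟩
  · simp only [Finset.coe_union, mem_union, not_or] at hxE
    exact (hE x hx hxE.1).mul (hE' x hx hxE.2)
  · obtain ⟨C, hC⟩ := hf R
    obtain ⟨C', hC'⟩ := hg R
    refine ⟨C * C', fun x hx => ?_⟩
    rw [abs_mul]
    exact mul_le_mul (hC x hx) (hC' x hx) (abs_nonneg _) ((abs_nonneg _).trans (hC x hx))

lemma neg {f : ℝ → ℝ} (hf : PWCont f) : PWCont fun x => -f x := by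
  simpa using (const (-1)).mul hf

lemma sub {f g : ℝ → ℝ} (hf : PWCont f) (hg : PWCont g) : PWCont fun x => f x - g x := by
  simpa [sub_eq_add_neg] using hf.add hg.neg

lemma sum {ι : Type*} {s : Finset ι} {f : ι → ℝ → ℝ} (h : ∀ i ∈ s, PWCont (f i)) :
    PWCont fun x => ∑ i ∈ s, f i x := by
  classical
  induction s using Finset.induction_on with
  | empty => simpa using const 0
  | insert i s hi ih =>
    simp only [Finset.sum_insert hi]
    exact (h i (by simp)).add (ih fun j hj => h j (by simp [hj]))

lemma aestronglyMeasurable {f : ℝ → ℝ} (hf : PWCont f) :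
    AEStronglyMeasurable f (volume.restrict (Ioi 0)) := by
  obtain ⟨⟨E, hE⟩, -⟩ := hf
  have hc : ContinuousOn f (Ioi 0 \ (E : Set ℝ)) := fun x hx =>
    (hE x hx.1 hx.2).continuousWithinAt
  have hm : MeasurableSet (Ioi (0 : ℝ) \ (E : Set ℝ)) :=
    measurableSet_Ioi.diff E.finite_toSet.measurableSet
  have h := hc.aestronglyMeasurable (μ := volume) hm
  rwa [Measure.restrict_congr_set
    (sdiff_null_ae_eq_self (E.finite_toSet.measure_zero volume))] at h

lemma intervalIntegrable {f : ℝ → ℝ} (hf : PWCont f) {a b : ℝ} (ha : 0 ≤ a) (hb : 0 ≤ b) :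
    IntervalIntegrable f volume a b := by
  obtain ⟨C, hC⟩ := hf.2 (max a b)
  rw [intervalIntegrable_iff]
  refine IntegrableOn.of_bound (by simp [uIoc]) (hf.aestronglyMeasurable.mono_set ?_) C ?_
  · intro x hx
    exact (le_min ha hb).trans_lt hx.1
  · refine (ae_restrict_iff' measurableSet_uIoc).2 (ae_of_all _ fun x hx => ?_)
    exact hC x ⟨(le_min ha hb).trans hx.1.le, hx.2⟩

lemma continuousOn_primitive {f : ℝ → ℝ} (hf : PWCont f) {a : ℝ} (ha : 0 ≤ a) :
    ContinuousOn (fun x => ∫ t in a..x, f t) (Ici 0) := by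
  intro x hx
  have hx : 0 ≤ x := hx
  have h := intervalIntegral.continuousOn_primitive_interval'
    (hf.intervalIntegrable le_rfl (show 0 ≤ max a x + 1 by positivity))
    (a := a) (by rw [uIcc_of_le (by positivity)]; exact ⟨ha, by linarith [le_max_left a x]⟩)
  rw [uIcc_of_le (by positivity)] at h
  refine (h x ⟨hx, by linarith [le_max_right a x]⟩).mono_of_mem_nhdsWithin ?_
  rw [← Ici_inter_Iic]
  exact inter_mem self_mem_nhdsWithin
    (mem_nhdsWithin_of_mem_nhds (Iic_mem_nhds (by linarith [le_max_right a x])))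

lemma hasDerivAt_primitive {f : ℝ → ℝ} (hf : PWCont f) {a x : ℝ} (ha : 0 ≤ a) (hx : 0 < x)
    (hfx : ContinuousAt f x) : HasDerivAt (fun x => ∫ t in a..x, f t) (f x) x :=
  intervalIntegral.integral_hasDerivAt_right (hf.intervalIntegrable ha hx.le)
    ⟨Ioi 0, Ioi_mem_nhds hx, hf.aestronglyMeasurable⟩ hfx

/-- The fundamental theorem of calculus on the half line, with a finite exceptional set. -/
lemma integral_eq_sub {f f' : ℝ → ℝ} (hf' : PWCont f') (hf : ContinuousOn f (Ici 0))
    {E : Finset ℝ} (hE : ∀ x ∈ Ioi (0 : ℝ), x ∉ (E : Set ℝ) → HasDerivAt f (f' x) x)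
    {a b : ℝ} (ha : 0 ≤ a) (hb : 0 ≤ b) : ∫ x in a..b, f' x = f b - f a := by
  refine integral_eq_of_hasDerivAt_off_countable f f' E.finite_toSet.countable
    (hf.mono fun x hx => (le_min ha hb).trans hx.1) (fun x hx => ?_)
    (hf'.intervalIntegrable ha hb)
  exact hE x ((le_min ha hb).trans_lt hx.1.1) hx.2

end PWCont

/-- A continuous function whose derivative off a finite set extends continuously is
differentiable everywhere. -/
lemma hasDerivWithinAt_Ici_of_off_finite {f f' : ℝ → ℝ} (hf : ContinuousOn f (Ici 0))
    (hf' : ContinuousOn f' (Ici 0)) {E : Finset ℝ}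
    (hE : ∀ x ∈ Ioi (0 : ℝ), x ∉ (E : Set ℝ) → HasDerivAt f (f' x) x) :
    ∀ x ∈ Ici (0 : ℝ), HasDerivWithinAt f (f' x) (Ici 0) x := by
  have hc : Continuous fun x => f' (max x 0) :=
    hf'.comp_continuous (by fun_prop) fun x => le_max_right x 0
  have heq : ∀ x ∈ Ici (0 : ℝ), f x = f 0 + ∫ t in (0 : ℝ)..x, f' (max t 0) := by
    intro x hx
    rw [(PWCont.of_continuousOn hc.continuousOn).integral_eq_sub hf (E := E)
      (fun t ht htE => by rw [max_eq_left (le_of_lt ht)]; exact hE t ht htE) le_rfl hx]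
    ring
  intro x hx
  have h : HasDerivAt (fun x => f 0 + ∫ t in (0 : ℝ)..x, f' (max t 0)) (f' x) x := by
    have := (hc.integral_hasStrictDerivAt 0 x).hasDerivAt.const_add (f 0)
    rwa [max_eq_left (show (0 : ℝ) ≤ x from hx)] at this
  exact h.hasDerivWithinAt.congr heq (heq x hx)

namespace ExpDecay

variable {β : ℝ} {f g : ℝ → ℝ}

lemma add (hf : ExpDecay β f) (hg : ExpDecay β g) : ExpDecay β fun x => f x + g x := by
  obtain ⟨C, hC⟩ := hf
  obtain ⟨C', hC'⟩ := hg
  refine ⟨C + C', fun x hx => (abs_add_le _ _).trans ?_⟩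
  rw [add_mul]
  exact add_le_add (hC x hx) (hC' x hx)

lemma bdd_mul {B : ℝ} (hg : ∀ x ∈ Ici (0 : ℝ), |g x| ≤ B) (hf : ExpDecay β f) :
    ExpDecay β fun x => g x * f x := by
  obtain ⟨C, hC⟩ := hf
  refine ⟨B * C, fun x hx => ?_⟩
  rw [abs_mul, mul_assoc]
  exact mul_le_mul (hg x hx) (hC x hx) (abs_nonneg _) ((abs_nonneg _).trans (hg x hx))

lemma const_mul (c : ℝ) (hf : ExpDecay β f) : ExpDecay β fun x => c * f x :=
  bdd_mul (g := fun _ => c) (B := |c|) (fun _ _ => le_rfl) hf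

lemma sub (hf : ExpDecay β f) (hg : ExpDecay β g) : ExpDecay β fun x => f x - g x := by
  simpa [sub_eq_add_neg] using hf.add (hg.const_mul (-1))

lemma zero : ExpDecay β fun _ => 0 := ⟨0, by simp⟩

lemma sum {ι : Type*} {s : Finset ι} {f : ι → ℝ → ℝ} (h : ∀ i ∈ s, ExpDecay β (f i)) :
    ExpDecay β fun x => ∑ i ∈ s, f i x := by
  classical
  induction s using Finset.induction_on with
  | empty => simpa using zero
  | insert i s hi ih =>
    simp only [Finset.sum_insert hi]
    exact (h i (by simp)).add (ih fun j hj => h j (by simp [hj]))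

lemma bounded (hβ : 0 < β) (hf : ExpDecay β f) : ∃ B, ∀ x ∈ Ici (0 : ℝ), |f x| ≤ B := by
  obtain ⟨C, hC⟩ := hf
  refine ⟨|C|, fun x hx => (hC x hx).trans ?_⟩
  have h1 : Real.exp (-β * x) ≤ 1 := Real.exp_le_one_iff.2 (by
    have : 0 ≤ β * x := mul_nonneg hβ.le hx
    linarith)
  calc C * Real.exp (-β * x) ≤ |C| * Real.exp (-β * x) := by gcongr; exact le_abs_self C
    _ ≤ |C| * 1 := by gcongr
    _ = |C| := mul_one _

lemma tendsto (hβ : 0 < β) (hf : ExpDecay β f) : Tendsto f atTop (nhds 0) := by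
  obtain ⟨C, hC⟩ := hf
  refine squeeze_zero_norm' (a := fun x => C * Real.exp (-β * x)) ?_ ?_
  · filter_upwards [eventually_ge_atTop 0] with x hx using hC x hx
  · rw [← mul_zero C]
    refine Tendsto.const_mul C (Real.tendsto_exp_atBot.comp ?_)
    exact tendsto_id.const_mul_atTop_of_neg (by linarith)

lemma integrableOn (hβ : 0 < β) (hf : ExpDecay β f) (hp : PWCont f) :
    IntegrableOn f (Ioi 0) := by
  obtain ⟨C, hC⟩ := hf
  refine Integrable.mono' ((exp_neg_integrableOn_Ioi 0 hβ).const_mul C)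
    hp.aestronglyMeasurable ?_
  exact (ae_restrict_iff' measurableSet_Ioi).2 (ae_of_all _ fun x hx => hC x (Ioi_subset_Ici_self hx))

/-- Exponential decay only has to be checked near infinity. -/
lemma of_tail (hf : PWCont f) {L C : ℝ} (h : ∀ x ≥ L, |f x| ≤ C * Real.exp (-β * x)) :
    ExpDecay β f := by
  obtain ⟨B, hB⟩ := hf.2 L
  refine ⟨|B| * Real.exp (|β| * |L|) + |C|, fun x hx => ?_⟩
  have hx : 0 ≤ x := hx
  rw [add_mul, mul_assoc, ← Real.exp_add]
  rcases le_total x L with hxL | hxL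
  · have h1 : 1 ≤ Real.exp (|β| * |L| + -β * x) := Real.one_le_exp (by
      have : β * x ≤ |β| * |L| := mul_le_mul (le_abs_self _) (hxL.trans (le_abs_self _)) hx
        (abs_nonneg _)
      linarith)
    calc |f x| ≤ |B| := (hB x ⟨hx, hxL⟩).trans (le_abs_self _)
      _ ≤ |B| * Real.exp (|β| * |L| + -β * x) := le_mul_of_one_le_right (abs_nonneg _) h1
      _ ≤ _ := le_add_of_nonneg_right (by positivity)
  · calc |f x| ≤ C * Real.exp (-β * x) := h x hxL
      _ ≤ |C| * Real.exp (-β * x) := by gcongr; exact le_abs_self C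
      _ ≤ _ := le_add_of_nonneg_left (by positivity)

end ExpDecay

namespace Sol1D

variable {d g h y y' z z' : ℝ → ℝ} {lam : ℝ}

lemma continuousOn (hy : Sol1D d lam g y y') : ContinuousOn y (Ici 0) :=
  fun x hx => (hy.1 x hx).continuousWithinAt

lemma hasDerivAt (hy : Sol1D d lam g y y') {x : ℝ} (hx : 0 < x) : HasDerivAt y (y' x) x :=
  (hy.1 x hx.le).hasDerivAt (Ici_mem_nhds hx)

lemma add_const_mul (hy : Sol1D d lam g y y') (hz : Sol1D d lam (fun _ => 0) z z') (c : ℝ) :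
    Sol1D d lam g (fun x => y x + c * z x) (fun x => y' x + c * z' x) := by
  obtain ⟨h1, h2, ⟨E, h3⟩, h4⟩ := hy
  obtain ⟨k1, k2, ⟨E', k3⟩, k4⟩ := hz
  refine ⟨fun x hx => (h1 x hx).add ((k1 x hx).const_mul c), h2.add (continuousOn_const.mul k2),
    ⟨E ∪ E', fun x hx hxE => ?_⟩, by simp [h4, k4]⟩
  simp only [Finset.coe_union, mem_union, not_or] at hxE
  refine ((h3 x hx hxE.1).add ((k3 x hx hxE.2).const_mul c)).congr_deriv ?_
  ring

/-- A nontrivial homogeneous solution never vanishes together with its derivative. -/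
lemma weight_pos (hd : PWCont d) {B : ℝ} (hB : ∀ x, |d x| ≤ B)
    (hy : Sol1D d lam (fun _ => 0) y y') (hne : ∃ x ∈ Ici (0 : ℝ), y x ≠ 0) :
    ∀ x ∈ Ici (0 : ℝ), 0 < y x ^ 2 + y' x ^ 2 := by
  obtain ⟨x₁, hx₁, hyx₁⟩ := hne
  obtain ⟨E, hE⟩ := hy.2.2.1
  set K : ℝ := 1 + B + |lam| with hK
  have hbound : ∀ x, |2 * y x * y' x * (1 + (d x - lam))| ≤ K * (y x ^ 2 + y' x ^ 2) := by
    intro x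
    have h1 : |1 + (d x - lam)| ≤ K := by
      have := abs_le.1 (hB x)
      have h2 := abs_le.1 (le_refl |lam|)
      exact abs_le.2 ⟨by linarith, by linarith⟩
    have h2 : |2 * y x * y' x| ≤ y x ^ 2 + y' x ^ 2 :=
      abs_le.2 ⟨by nlinarith [sq_nonneg (y x + y' x)], by nlinarith [sq_nonneg (y x - y' x)]⟩
    rw [abs_mul, mul_comm K]
    exact mul_le_mul h2 h1 (abs_nonneg _) (by positivity)
  have hder : ∀ c, ∀ x ∈ Ioi (0 : ℝ), x ∉ (E : Set ℝ) →
      HasDerivAt (fun x => (y x ^ 2 + y' x ^ 2) * Real.exp (c * x))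
        ((2 * y x * y' x * (1 + (d x - lam)) + c * (y x ^ 2 + y' x ^ 2)) * Real.exp (c * x)) x := by
    intro c x hx hxE
    have he : HasDerivAt (fun x => Real.exp (c * x)) (Real.exp (c * x) * c) x := by
      simpa using ((hasDerivAt_id x).const_mul c).exp
    refine ((((hy.hasDerivAt hx).pow 2).add ((hE x hx hxE).pow 2)).mul he).congr_deriv ?_
    simp
    ring
  have hpy := PWCont.of_continuousOn hy.continuousOn
  have hpy' := PWCont.of_continuousOn hy.2.1
  have hwc : ContinuousOn (fun x => y x ^ 2 + y' x ^ 2) (Ici 0) :=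
    (hy.continuousOn.pow 2).add (hy.2.1.pow 2)
  have hftc : ∀ c a b : ℝ, 0 ≤ a → 0 ≤ b →
      ∫ x in a..b, (2 * y x * y' x * (1 + (d x - lam)) + c * (y x ^ 2 + y' x ^ 2)) *
        Real.exp (c * x) = (y b ^ 2 + y' b ^ 2) * Real.exp (c * b) -
          (y a ^ 2 + y' a ^ 2) * Real.exp (c * a) := by
    intro c a b ha hb
    refine PWCont.integral_eq_sub ?_ (hwc.mul (by fun_prop)) (hder c) ha hb
    refine (((((PWCont.const 2).mul hpy).mul hpy').mul
      ((PWCont.const 1).add (hd.sub (PWCont.const lam)))).add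
      ((PWCont.const c).mul (PWCont.of_continuousOn hwc))).mul (PWCont.of_continuousOn ?_)
    fun_prop
  intro x hx
  by_contra hneg
  have hx0 : y x ^ 2 + y' x ^ 2 = 0 := le_antisymm (not_lt.1 hneg) (by positivity)
  have hpos : 0 < y x₁ ^ 2 + y' x₁ ^ 2 := by positivity
  rcases le_total x x₁ with hle | hle
  · have h := hftc (-K) x x₁ hx hx₁
    have h2 : ∫ x in x..x₁, (2 * y x * y' x * (1 + (d x - lam)) + -K * (y x ^ 2 + y' x ^ 2)) *
        Real.exp (-K * x) ≤ 0 := by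
      rw [← neg_nonneg, ← intervalIntegral.integral_neg]
      refine intervalIntegral.integral_nonneg hle fun t _ => ?_
      have := (abs_le.1 (hbound t)).2
      rw [← neg_mul]
      exact mul_nonneg (by linarith) (Real.exp_pos _).le
    rw [h, hx0] at h2
    have := mul_pos hpos (Real.exp_pos (-K * x₁))
    linarith
  · have h := hftc K x₁ x hx₁ hx
    have h2 : 0 ≤ ∫ x in x₁..x, (2 * y x * y' x * (1 + (d x - lam)) + K * (y x ^ 2 + y' x ^ 2)) *
        Real.exp (K * x) := by
      refine intervalIntegral.integral_nonneg hle fun t _ => ?_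
      have := (abs_le.1 (hbound t)).1
      exact mul_nonneg (by linarith) (Real.exp_pos _).le
    rw [h, hx0] at h2
    have := mul_pos hpos (Real.exp_pos (K * x₁))
    linarith

/-- Variation of constants, based on a single homogeneous solution `z`: the pair
`(z, z')` is completed to a frame by `(-z', z) / (z² + z'²)`. -/
lemma variation_of_constants (hd : PWCont d) (hg : PWCont g)
    (hz : Sol1D d lam (fun _ => 0) z z') (hw : ∀ x ∈ Ici (0 : ℝ), 0 < z x ^ 2 + z' x ^ 2)
    {L : ℝ} (hL : 0 ≤ L) :
    ∃ a b a' : ℝ → ℝ, (∀ x, b x = -∫ t in (0 : ℝ)..x, z t * g t) ∧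
      (∀ x, a x = ∫ t in L..x, a' t) ∧
      (∀ x, a' x = b x * ((1 + (d x - lam)) * (z x ^ 2 - z' x ^ 2) / (z x ^ 2 + z' x ^ 2) ^ 2) -
        z' x * g x / (z x ^ 2 + z' x ^ 2)) ∧
      Sol1D d lam g (fun x => a x * z x - b x * (z' x / (z x ^ 2 + z' x ^ 2)))
        (fun x => a x * z' x + b x * (z x / (z x ^ 2 + z' x ^ 2))) := by
  set w : ℝ → ℝ := fun x => z x ^ 2 + z' x ^ 2 with hwdef
  have hw0 : ∀ x ∈ Ici (0 : ℝ), w x ≠ 0 := fun x hx => (hw x hx).ne'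
  set b : ℝ → ℝ := fun x => -∫ t in (0 : ℝ)..x, z t * g t with hb
  set a' : ℝ → ℝ := fun x => b x * ((1 + (d x - lam)) * (z x ^ 2 - z' x ^ 2) / w x ^ 2) -
    z' x * g x / w x with ha'
  set a : ℝ → ℝ := fun x => ∫ t in L..x, a' t with ha
  have hzc := hz.continuousOn
  have hzc' := hz.2.1
  have hwc : ContinuousOn w (Ici 0) := (hzc.pow 2).add (hzc'.pow 2)
  have hpz := PWCont.of_continuousOn hzc
  have hpz' := PWCont.of_continuousOn hzc'
  have hpzg : PWCont fun x => z x * g x := hpz.mul hg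
  have hbc : ContinuousOn b (Ici 0) := (hpzg.continuousOn_primitive le_rfl).neg
  have hpa' : PWCont a' := by
    have h1 : PWCont fun x => b x * ((1 + (d x - lam)) * ((z x ^ 2 - z' x ^ 2) * (w x ^ 2)⁻¹)) :=
      (PWCont.of_continuousOn hbc).mul (((PWCont.const 1).add (hd.sub (PWCont.const lam))).mul
        (PWCont.of_continuousOn (((hzc.pow 2).sub (hzc'.pow 2)).mul
          ((hwc.pow 2).inv₀ fun x hx => pow_ne_zero 2 (hw0 x hx)))))
    have h2 : PWCont fun x => z' x * g x * (w x)⁻¹ :=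
      (hpz'.mul hg).mul (PWCont.of_continuousOn (hwc.inv₀ hw0))
    have h3 := h1.sub h2
    have heq : a' = fun x => b x * ((1 + (d x - lam)) * ((z x ^ 2 - z' x ^ 2) * (w x ^ 2)⁻¹)) -
        z' x * g x * (w x)⁻¹ := by
      funext x
      simp only [ha', div_eq_mul_inv]
      ring
    rwa [heq]
  have hac : ContinuousOn a (Ici 0) := hpa'.continuousOn_primitive hL
  obtain ⟨E₁, hE₁⟩ := hz.2.2.1
  obtain ⟨E₂, hE₂⟩ := hpzg.1
  obtain ⟨E₃, hE₃⟩ := hpa'.1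
  have hder : ∀ x ∈ Ioi (0 : ℝ), x ∉ ((E₁ ∪ E₂ ∪ E₃ : Finset ℝ) : Set ℝ) →
      HasDerivAt z (z' x) x ∧ HasDerivAt z' (d x * z x - lam * z x) x ∧
      HasDerivAt b (-(z x * g x)) x ∧ HasDerivAt a (a' x) x ∧
      HasDerivAt w (2 * z x * z' x + 2 * z' x * (d x * z x - lam * z x)) x := by
    intro x hx hxE
    simp only [Finset.coe_union, mem_union, not_or] at hxE
    have hzx := hz.hasDerivAt hx
    have hzx' : HasDerivAt z' (d x * z x - lam * z x) x := by
      simpa using hE₁ x hx hxE.1.1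
    refine ⟨hzx, hzx', (hpzg.hasDerivAt_primitive le_rfl hx (hE₂ x hx hxE.1.2)).neg,
      hpa'.hasDerivAt_primitive hL hx (hE₃ x hx hxE.2), ?_⟩
    refine ((hzx.pow 2).add (hzx'.pow 2)).congr_deriv ?_
    simp
  refine ⟨a, b, a', fun _ => rfl, fun _ => rfl, fun _ => rfl, ?_⟩
  have hyc : ContinuousOn (fun x => a x * z x - b x * (z' x / w x)) (Ici 0) :=
    (hac.mul hzc).sub (hbc.mul (hzc'.div hwc hw0))
  have hyc' : ContinuousOn (fun x => a x * z' x + b x * (z x / w x)) (Ici 0) :=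
    (hac.mul hzc').add (hbc.mul (hzc.div hwc hw0))
  refine ⟨hasDerivWithinAt_Ici_of_off_finite hyc hyc' (E := E₁ ∪ E₂ ∪ E₃) ?_, hyc',
    ⟨E₁ ∪ E₂ ∪ E₃, ?_⟩, ?_⟩
  · intro x hx hxE
    obtain ⟨h1, h2, h3, h4, h5⟩ := hder x hx hxE
    have hwx := hw0 x (Ioi_subset_Ici_self hx)
    refine ((h4.mul h1).sub (h3.mul (h2.div h5 hwx))).congr_deriv ?_
    have hwv : z x ^ 2 + z' x ^ 2 = w x := rfl
    simp only [ha', Pi.div_apply, hwv]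
    field_simp
    simp only [hwdef]
    ring
  · intro x hx hxE
    obtain ⟨h1, h2, h3, h4, h5⟩ := hder x hx hxE
    have hwx := hw0 x (Ioi_subset_Ici_self hx)
    refine ((h4.mul h2).add (h3.mul (h1.div h5 hwx))).congr_deriv ?_
    have hwv : z x ^ 2 + z' x ^ 2 = w x := rfl
    simp only [ha', Pi.div_apply, hwv]
    field_simp
    simp only [hwdef]
    ring
  · simp [hz.2.2.2, hb]

/-- A homogeneous solution decaying to zero is a pure exponential where `d = 1`. -/
lemma eq_exp_of_tendsto {L κ : ℝ} (hL : 0 ≤ L) (hκ : 0 < κ) (hlam : lam = 1 - κ ^ 2)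
    (hdL : ∀ x ≥ L, d x = 1) (hy : Sol1D d lam (fun _ => 0) y y')
    (hlim : Tendsto y atTop (nhds 0)) :
    ∃ c, ∀ x ≥ L, y x = c * Real.exp (-κ * x) ∧ y' x = -κ * (c * Real.exp (-κ * x)) := by
  obtain ⟨E, hE⟩ := hy.2.2.1
  have key : ∀ σ : ℝ, σ ^ 2 = κ ^ 2 → ∀ x ≥ L,
      (y' x + σ * y x) * Real.exp (-σ * x) = (y' L + σ * y L) * Real.exp (-σ * L) := by
    intro σ hσ x hx
    have hx0 : 0 ≤ x := hL.trans hx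
    have hc : ContinuousOn (fun x => (y' x + σ * y x) * Real.exp (-σ * x)) (Ici 0) :=
      (hy.2.1.add (continuousOn_const.mul hy.continuousOn)).mul (by fun_prop)
    have h := integral_eq_of_hasDerivAt_off_countable
      (fun x => (y' x + σ * y x) * Real.exp (-σ * x)) (fun _ => 0) (a := L) (b := x)
      E.finite_toSet.countable
      (hc.mono fun t ht => (le_min hL hx0).trans ht.1) (fun t ht => ?_) (by simp)
    · simp only [intervalIntegral.integral_zero] at h
      linarith
    · have htL : L < t := by simpa [hx] using ht.1.1
      have ht0 : 0 < t := hL.trans_lt htL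
      have he : HasDerivAt (fun x => Real.exp (-σ * x)) (Real.exp (-σ * t) * -σ) t := by
        simpa using ((hasDerivAt_id t).const_mul (-σ)).exp
      refine (((hE t ht0 ht.2).add ((hy.hasDerivAt ht0).const_mul σ)).mul he).congr_deriv ?_
      rw [hdL t htL.le, hlam, ← hσ, Pi.add_apply]
      ring
  have hp : ∀ x ≥ L, y' x + κ * y x = (y' L + κ * y L) * Real.exp (-κ * L) * Real.exp (κ * x) := by
    intro x hx
    rw [← key κ rfl x hx, mul_assoc, ← Real.exp_add]
    simp
  have hm : ∀ x ≥ L, y' x - κ * y x = (y' L - κ * y L) * Real.exp (κ * L) * Real.exp (-κ * x) := by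
    intro x hx
    have h := key (-κ) (by ring) x hx
    simp only [neg_neg, neg_mul] at h
    rw [sub_eq_add_neg, sub_eq_add_neg, ← h, mul_assoc, ← Real.exp_add]
    simp
  set u := (y' L + κ * y L) * Real.exp (-κ * L) with hu
  set v := (y' L - κ * y L) * Real.exp (κ * L) with hv
  have hlin : Tendsto (fun x : ℝ => -κ * x) atTop atBot :=
    tendsto_id.const_mul_atTop_of_neg (by linarith)
  have hexp := Real.tendsto_exp_atBot.comp hlin
  have hu0 : u = 0 := by
    have h1 : Tendsto (fun x => (2 * κ * y x + v * Real.exp (-κ * x)) * Real.exp (-κ * x)) atTop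
        (nhds ((2 * κ * 0 + v * 0) * 0)) :=
      ((hlim.const_mul _).add (hexp.const_mul v)).mul hexp
    have h2 : Tendsto (fun x => (2 * κ * y x + v * Real.exp (-κ * x)) * Real.exp (-κ * x)) atTop
        (nhds u) := by
      refine tendsto_const_nhds.congr' ?_
      filter_upwards [eventually_ge_atTop L] with x hx
      rw [← hm x hx, show 2 * κ * y x + (y' x - κ * y x) = y' x + κ * y x by ring, hp x hx,
        mul_assoc, ← Real.exp_add]
      simp
    simpa using tendsto_nhds_unique h2 h1
  refine ⟨-v / (2 * κ), fun x hx => ?_⟩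
  have h1 := hp x hx
  have h2 := hm x hx
  rw [hu0, zero_mul] at h1
  have h3 : v * Real.exp (-κ * x) = -(2 * κ * y x) := by linarith
  have h4 : -v / (2 * κ) * Real.exp (-κ * x) = y x := by
    rw [div_mul_eq_mul_div, neg_mul, h3]
    field_simp
  rw [h4]
  exact ⟨rfl, by linarith⟩

end Sol1D

lemma integral_exp_mul_Ioi_neg {σ : ℝ} (hσ : 0 < σ) (x : ℝ) :
    ∫ t in Ioi x, Real.exp (-σ * t) = Real.exp (-σ * x) / σ := by
  rw [integral_exp_mul_Ioi (by linarith)]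
  field_simp

lemma integral_exp_mul_le {σ : ℝ} (hσ : 0 < σ) (a b : ℝ) :
    ∫ t in a..b, Real.exp (σ * t) ≤ Real.exp (σ * b) / σ := by
  have h : ∀ t ∈ uIcc a b, HasDerivAt (fun t => Real.exp (σ * t) / σ) (Real.exp (σ * t)) t := by
    intro t _
    have := (((hasDerivAt_id t).const_mul σ).exp).div_const σ
    simpa [hσ.ne'] using this
  rw [intervalIntegral.integral_eq_sub_of_hasDerivAt h
    ((by fun_prop : Continuous fun t => Real.exp (σ * t)).intervalIntegrable a b)]
  have := div_pos (Real.exp_pos (σ * a)) hσ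
  linarith

lemma neg_integral_eq_tail {f : ℝ → ℝ} (hf : IntegrableOn f (Ioi 0))
    (h0 : ∫ t in Ioi (0 : ℝ), f t = 0) {x : ℝ} (hx : 0 ≤ x) :
    -∫ t in (0 : ℝ)..x, f t = ∫ t in Ioi x, f t := by
  have h := intervalIntegral.integral_interval_add_Ioi hf (hf.mono_set (Ioi_subset_Ioi hx))
  linarith

namespace Sol1D

variable {d g z z' : ℝ → ℝ} {lam L : ℝ}

/-- Solvability for a compactly supported source orthogonal to the homogeneous solution: the
solution may be chosen to vanish outside the support. -/
lemma exists_vanishing (hd : PWCont d) (hg : PWCont g) (hL : 0 ≤ L)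
    (hz : Sol1D d lam (fun _ => 0) z z') (hw : ∀ x ∈ Ici (0 : ℝ), 0 < z x ^ 2 + z' x ^ 2)
    (hgL : ∀ x ≥ L, g x = 0) (hort : ∫ x in Ioi (0 : ℝ), z x * g x = 0) :
    ∃ y y', Sol1D d lam g y y' ∧ ∀ x ≥ L, y x = 0 := by
  obtain ⟨a, b, a', hb, ha, ha', hy⟩ := variation_of_constants hd hg hz hw hL
  have hpzg : PWCont fun x => z x * g x := (PWCont.of_continuousOn hz.continuousOn).mul hg
  have hint : IntegrableOn (fun x => z x * g x) (Ioi 0) :=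
    (ExpDecay.of_tail (β := 1) (L := L) (C := 0) hpzg
      fun x hx => by simp [hgL x hx]).integrableOn one_pos hpzg
  have hbL : ∀ x ≥ L, b x = 0 := by
    intro x hx
    rw [hb, neg_integral_eq_tail hint hort (hL.trans hx)]
    refine (setIntegral_congr_fun measurableSet_Ioi fun t ht => ?_).trans
      (integral_zero ℝ ℝ)
    simp [hgL t (hx.trans (le_of_lt ht))]
  have haL : ∀ x ≥ L, a x = 0 := by
    intro x hx
    rw [ha, intervalIntegral.integral_congr (g := fun _ => (0 : ℝ)) ?_]
    · simp
    · intro t ht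
      rw [uIcc_of_le hx] at ht
      simp [ha', hbL t ht.1, hgL t ht.1]
  exact ⟨_, _, hy, fun x hx => by simp [haL x hx, hbL x hx]⟩

/-- Solvability for an exponentially decaying source orthogonal to an exponentially decaying
homogeneous solution. -/
lemma exists_expDecay {κ β c : ℝ} (hd : PWCont d) (hg : PWCont g) (hL : 0 ≤ L)
    (hβ : 0 < β) (hβκ : β < κ) (hlam : lam = 1 - κ ^ 2) (hdL : ∀ x ≥ L, d x = 1)
    (hz : Sol1D d lam (fun _ => 0) z z') (hw : ∀ x ∈ Ici (0 : ℝ), 0 < z x ^ 2 + z' x ^ 2)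
    (hzL : ∀ x ≥ L, z x = c * Real.exp (-κ * x) ∧ z' x = -κ * (c * Real.exp (-κ * x)))
    (hgβ : ExpDecay β g) (hort : ∫ x in Ioi (0 : ℝ), z x * g x = 0) :
    ∃ y y', Sol1D d lam g y y' ∧ ExpDecay β y := by
  obtain ⟨a, b, a', hb, ha, ha', hy⟩ := variation_of_constants hd hg hz hw hL
  have hκ : 0 < κ := hβ.trans hβκ
  have hc : 0 < |c| := by
    refine abs_pos.2 fun h0 => ?_
    have h := hw L hL
    rw [(hzL L le_rfl).1, (hzL L le_rfl).2, h0] at h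
    simp at h
  obtain ⟨C, hC⟩ := hgβ
  have hC0 : 0 ≤ C := by
    have := (abs_nonneg _).trans (hC 0 self_mem_Ici)
    simpa using this
  have hpz := PWCont.of_continuousOn hz.continuousOn
  have hpzg : PWCont fun x => z x * g x := hpz.mul hg
  have hzg : ∀ x ≥ L, |z x * g x| ≤ |c| * C * Real.exp (-(κ + β) * x) := by
    intro x hx
    rw [abs_mul, (hzL x hx).1, abs_mul, Real.abs_exp,
      show -(κ + β) * x = -κ * x + -β * x by ring, Real.exp_add,
      show |c| * C * (Real.exp (-κ * x) * Real.exp (-β * x)) =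
        |c| * Real.exp (-κ * x) * (C * Real.exp (-β * x)) by ring]
    exact mul_le_mul_of_nonneg_left (hC x (hL.trans hx)) (by positivity)
  have hint : IntegrableOn (fun x => z x * g x) (Ioi 0) :=
    (ExpDecay.of_tail hpzg hzg).integrableOn (by linarith) hpzg
  set B := |c| * C / (κ + β) with hB
  have hB0 : 0 ≤ B := by positivity
  have hbL : ∀ x ≥ L, |b x| ≤ B * Real.exp (-(κ + β) * x) := by
    intro x hx
    rw [hb, neg_integral_eq_tail hint hort (hL.trans hx)]
    have h1 : IntegrableOn (fun t => |c| * C * Real.exp (-(κ + β) * t)) (Ioi x) :=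
      (exp_neg_integrableOn_Ioi x (by linarith)).const_mul _
    refine (norm_integral_le_of_norm_le (f := fun t => z t * g t) h1 ((ae_restrict_iff' measurableSet_Ioi).2
      (ae_of_all _ fun t ht => hzg t (hx.trans (le_of_lt ht))))).trans_eq ?_
    rw [integral_const_mul, integral_exp_mul_Ioi_neg (by linarith)]
    ring
  have hweight : ∀ x ≥ L, z x ^ 2 + z' x ^ 2 = (1 + κ ^ 2) * (c * Real.exp (-κ * x)) ^ 2 := by
    intro x hx
    rw [(hzL x hx).1, (hzL x hx).2]
    ring
  have hc0 : c ≠ 0 := abs_pos.1 hc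
  have hexp0 : ∀ x, Real.exp (-κ * x) ≠ 0 := fun x => (Real.exp_pos _).ne'
  have hzw : ∀ x ≥ L, |z' x / (z x ^ 2 + z' x ^ 2)| ≤ |c|⁻¹ * Real.exp (κ * x) := by
    intro x hx
    rw [hweight x hx, (hzL x hx).2]
    have h1 : -κ * (c * Real.exp (-κ * x)) / ((1 + κ ^ 2) * (c * Real.exp (-κ * x)) ^ 2) =
        -(κ / (1 + κ ^ 2)) * (c⁻¹ * Real.exp (κ * x)) := by
      have h2 : Real.exp (κ * x) = (Real.exp (-κ * x))⁻¹ := by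
        rw [← Real.exp_neg]; congr 1; ring
      have h3 := hexp0 x
      rw [h2]
      field_simp
    rw [h1, abs_mul, abs_neg, abs_mul, abs_inv, Real.abs_exp, abs_of_nonneg (by positivity)]
    refine mul_le_of_le_one_left (by positivity) ?_
    rw [div_le_one (by positivity)]
    nlinarith [sq_nonneg (κ - 1)]
  have hhw : ∀ x ≥ L, |(1 + (d x - lam)) * (z x ^ 2 - z' x ^ 2) / (z x ^ 2 + z' x ^ 2) ^ 2| ≤
      (c ^ 2)⁻¹ * Real.exp (2 * κ * x) := by
    intro x hx
    rw [hweight x hx, (hzL x hx).1, (hzL x hx).2, hdL x hx, hlam]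
    have h1 : (1 + (1 - (1 - κ ^ 2))) * ((c * Real.exp (-κ * x)) ^ 2 -
        (-κ * (c * Real.exp (-κ * x))) ^ 2) / ((1 + κ ^ 2) * (c * Real.exp (-κ * x)) ^ 2) ^ 2 =
        ((1 - κ ^ 2) / (1 + κ ^ 2)) * ((c ^ 2)⁻¹ * Real.exp (2 * κ * x)) := by
      have h2 : Real.exp (2 * κ * x) = (Real.exp (-κ * x) ^ 2)⁻¹ := by
        rw [← Real.exp_nat_mul, ← Real.exp_neg]; congr 1; push_cast; ring
      have h3 := hexp0 x
      rw [h2]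
      field_simp
      ring
    rw [h1, abs_mul, abs_of_nonneg (show 0 ≤ (c ^ 2)⁻¹ * Real.exp (2 * κ * x) by positivity)]
    refine mul_le_of_le_one_left (by positivity) ?_
    rw [abs_div, abs_of_pos (show 0 < 1 + κ ^ 2 by positivity), div_le_one (by positivity)]
    exact abs_le.2 ⟨by nlinarith, by nlinarith⟩
  set A := B * (c ^ 2)⁻¹ + |c|⁻¹ * C with hA
  have haL' : ∀ x ≥ L, |a' x| ≤ A * Real.exp ((κ - β) * x) := by
    intro x hx
    rw [hA, add_mul, ha']
    refine (abs_sub _ _).trans (add_le_add ?_ ?_)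
    · rw [abs_mul]
      refine (mul_le_mul (hbL x hx) (hhw x hx) (abs_nonneg _) (by positivity)).trans_eq ?_
      rw [show (κ - β) * x = -(κ + β) * x + 2 * κ * x by ring, Real.exp_add]
      ring
    · rw [mul_div_right_comm, abs_mul]
      refine (mul_le_mul (hzw x hx) (hC x (hL.trans hx)) (abs_nonneg _) (by positivity)).trans_eq ?_
      rw [show (κ - β) * x = κ * x + -β * x by ring, Real.exp_add]
      ring
  have haL : ∀ x ≥ L, |a x| ≤ A / (κ - β) * Real.exp ((κ - β) * x) := by
    intro x hx
    rw [ha]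
    refine (intervalIntegral.norm_integral_le_of_norm_le (f := a')
      (g := fun t => A * Real.exp ((κ - β) * t)) hx
      (ae_of_all _ fun t ht => haL' t ht.1.le)
      ((by fun_prop : Continuous _).intervalIntegrable _ _)).trans ?_
    rw [intervalIntegral.integral_const_mul, div_mul_eq_mul_div, mul_div_assoc]
    exact mul_le_mul_of_nonneg_left (integral_exp_mul_le (by linarith) _ _) (by positivity)
  refine ⟨_, _, hy, ExpDecay.of_tail (L := L) (C := A / (κ - β) * |c| + B * |c|⁻¹)
    (PWCont.of_continuousOn hy.continuousOn) fun x hx => ?_⟩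
  rw [add_mul]
  refine (abs_sub _ _).trans (add_le_add ?_ ?_)
  · rw [abs_mul, (hzL x hx).1, abs_mul, Real.abs_exp]
    refine (mul_le_mul_of_nonneg_right (haL x hx) (by positivity)).trans_eq ?_
    rw [show -β * x = (κ - β) * x + -κ * x by ring, Real.exp_add]
    ring
  · rw [abs_mul]
    refine (mul_le_mul (hbL x hx) (hzw x hx) (abs_nonneg _) (by positivity)).trans_eq ?_
    rw [show -β * x = -(κ + β) * x + κ * x by ring, Real.exp_add]
    ring

/-- The decaying solution can be made orthogonal to the normalized bound state. -/
lemma exists_expDecay_orthogonal {κ β c : ℝ} (hd : PWCont d) (hg : PWCont g) (hL : 0 ≤ L)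
    (hβ : 0 < β) (hβκ : β < κ) (hlam : lam = 1 - κ ^ 2) (hdL : ∀ x ≥ L, d x = 1)
    (hz : Sol1D d lam (fun _ => 0) z z') (hw : ∀ x ∈ Ici (0 : ℝ), 0 < z x ^ 2 + z' x ^ 2)
    (hzL : ∀ x ≥ L, z x = c * Real.exp (-κ * x) ∧ z' x = -κ * (c * Real.exp (-κ * x)))
    (hzβ : ExpDecay β z) (hnorm : ∫ x in Ioi (0 : ℝ), z x ^ 2 = 1)
    (hgβ : ExpDecay β g) (hort : ∫ x in Ioi (0 : ℝ), z x * g x = 0) :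
    ∃ y y', Sol1D d lam g y y' ∧ ExpDecay β y ∧ ∫ x in Ioi (0 : ℝ), z x * y x = 0 := by
  obtain ⟨y, y', hy, hyβ⟩ := exists_expDecay hd hg hL hβ hβκ hlam hdL hz hw hzL hgβ hort
  have hpz := PWCont.of_continuousOn hz.continuousOn
  obtain ⟨B, hB⟩ := hzβ.bounded hβ
  have h1 : IntegrableOn (fun x => z x * y x) (Ioi 0) :=
    (hyβ.bdd_mul hB).integrableOn hβ (hpz.mul (PWCont.of_continuousOn hy.continuousOn))
  have h2 : IntegrableOn (fun x => z x ^ 2) (Ioi 0) := by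
    simpa [sq] using (hzβ.bdd_mul hB).integrableOn hβ (hpz.mul hpz)
  refine ⟨_, _, hy.add_const_mul hz (-∫ x in Ioi (0 : ℝ), z x * y x), hyβ.add (hzβ.const_mul _),
    ?_⟩
  have h3 : ∀ x, z x * (y x + (-∫ x in Ioi (0 : ℝ), z x * y x) * z x) =
      z x * y x + (-∫ x in Ioi (0 : ℝ), z x * y x) * z x ^ 2 := fun x => by ring
  simp only [h3]
  rw [integral_add h1 (h2.const_mul _), integral_const_mul, hnorm]
  ring

end Sol1D

/-- A bound state below the threshold decays exponentially, and the inhomogeneous problem with a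
decaying source is solvable in decaying functions if the source is orthogonal to it. -/
lemma IsBoundState1D.solvable {d φ φ' : ℝ → ℝ} {lam L κ β B : ℝ} (hd : PWCont d)
    (hB : ∀ x, |d x| ≤ B) (hL : 0 ≤ L) (hβ : 0 < β) (hβκ : β < κ) (hlam : lam = 1 - κ ^ 2)
    (hdL : ∀ x ≥ L, d x = 1) (hφ : IsBoundState1D d lam φ φ')
    (hnorm : ∫ x in Ioi (0 : ℝ), φ x ^ 2 = 1) :
    ExpDecay β φ ∧ ∀ g, PWCont g → ExpDecay β g → ∫ x in Ioi (0 : ℝ), φ x * g x = 0 →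
      ∃ y y', Sol1D d lam g y y' ∧ ExpDecay β y ∧ ∫ x in Ioi (0 : ℝ), φ x * y x = 0 := by
  obtain ⟨hsol, hlim, hne⟩ := hφ
  obtain ⟨c, hc⟩ := hsol.eq_exp_of_tendsto hL (hβ.trans hβκ) hlam hdL hlim
  have hdecay : ExpDecay β φ := by
    refine ExpDecay.of_tail (L := L) (C := |c|) (PWCont.of_continuousOn hsol.continuousOn)
      fun x hx => ?_
    rw [(hc x hx).1, abs_mul, Real.abs_exp]
    refine mul_le_mul_of_nonneg_left (Real.exp_le_exp.2 ?_) (abs_nonneg _)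
    have := mul_le_mul_of_nonneg_right hβκ.le (hL.trans hx)
    linarith
  exact ⟨hdecay, fun g hg hgβ hort => hsol.exists_expDecay_orthogonal hd hg hL hβ hβκ hlam hdL
    (hsol.weight_pos hd hB hne) hc hdecay hnorm hgβ hort⟩

lemma DiagBVPSol.of_components {D : ℝ → Fin 3 → ℝ} {lam : ℝ} {g y y' : ℝ → Fin 3 → ℝ}
    (h : ∀ i, Sol1D (fun x => D x i) lam (fun x => g x i) (fun x => y x i) (fun x => y' x i))
    (hlim : ∀ i, Tendsto (fun x => y x i) atTop (nhds 0)) : DiagBVPSol D lam g y y' := by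
  choose E hE using fun i => (h i).2.2.1
  refine ⟨fun x hx => hasDerivWithinAt_pi.2 fun i => (h i).1 x hx,
    continuousOn_pi.2 fun i => (h i).2.1, ⟨Finset.univ.biUnion E, fun x hx hxE => ?_⟩,
    funext fun i => (h i).2.2.2, tendsto_pi_nhds.2 hlim⟩
  refine hasDerivAt_pi.2 fun i => hE i x hx fun hi => hxE ?_
  simp only [Finset.coe_biUnion, mem_iUnion]
  exact ⟨i, by simp, hi⟩

/-- Construction of a sequence by choosing each term in terms of all the previous ones. -/
lemma exists_seq_of_history {α : Type*} [Nonempty α] (P : ℕ → (ℕ → α) → Prop)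
    (step : ∀ n f, (∀ k < n, P k f) →
      ∃ a, ∀ f', (∀ k < n, f' k = f k) → f' n = a → P n f') : ∃ f, ∀ n, P n f := by
  classical
  let Q : ℕ → (ℕ → α) → α → Prop := fun n h a =>
    ∀ f', (∀ k < n, f' k = h k) → f' n = a → P n f'
  let sel : ℕ → (ℕ → α) → α := fun n h => Classical.epsilon (Q n h)
  let G : ℕ → ℕ → α := fun n =>
    Nat.rec (fun _ => Classical.arbitrary α) (fun m h => Function.update h m (sel m h)) n
  have hG : ∀ n, G (n + 1) = Function.update (G n) n (sel n (G n)) := fun _ => rfl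
  have hagree : ∀ n, ∀ k < n, G (k + 1) k = G n k := by
    intro n
    induction n with
    | zero => intro k hk; omega
    | succ n ih =>
      intro k hk
      rcases Nat.lt_succ_iff_lt_or_eq.1 hk with h | rfl
      · rw [ih k h, hG n, Function.update_of_ne h.ne]
      · rfl
  refine ⟨fun k => G (k + 1) k, fun n => ?_⟩
  induction n using Nat.strong_induction_on with
  | _ n ih =>
    obtain ⟨a, ha⟩ := step n _ ih
    have hex : ∃ a, Q n (G n) a :=
      ⟨a, fun f' h1 h2 => ha f' (fun k hk => (h1 k hk).trans (hagree n k hk).symm) h2⟩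
    refine Classical.epsilon_spec hex _ (hagree n) ?_
    simp only [hG, Function.update_self]
    rfl

/-- The data of one order of the perturbation expansion. -/
structure ExpansionTerm where
  /-- coefficient of the eigenvalue -/
  lam : ℝ
  /-- coefficient of the parameter -/
  s : ℝ
  /-- weight of the orthogonal bound state -/
  gam : ℝ
  /-- coefficient of the wave function -/
  y : ℝ → Fin 3 → ℝ
  /-- its derivative -/
  y' : ℝ → Fin 3 → ℝ
  /-- particular solution -/
  p : ℝ → Fin 3 → ℝ
  /-- its derivative -/
  p' : ℝ → Fin 3 → ℝ

instance : Nonempty ExpansionTerm := ⟨⟨0, 0, 0, 0, 0, 0, 0⟩⟩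

/-- The source at order `n + 1`, with the sum truncated to the first `m` coefficients. -/
def truncatedSource (D1 : ℝ → Fin 3 → ℝ) (F : ℝ → Fin 3 → Fin 3 → ℝ) (S : ℕ → ExpansionTerm)
    (m n : ℕ) (x : ℝ) (i : Fin 3) : ℝ :=
  (∑ k ∈ Finset.Icc 1 m, ((S k).lam - (S k).s * D1 x i) * (S (n + 1 - k)).y x i) -
    ∑ j, F x i j * (S n).y x j

/-- Solvability of one order of the expansion: two free coefficients achieve orthogonality to
both bound states. -/
lemma exists_coefficients {D0 D1 R : ℝ → Fin 3 → ℝ} {lam0 L β : ℝ} (hβ : 0 < β)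
    {φ0 φ1 φ2 : ℝ → ℝ} {C1 C2 : ℝ} (hC1 : C1 ≠ 0) (hC2 : C2 ≠ 0)
    (hD1 : ∀ i, PWCont fun x => D1 x i) {B : ℝ} (hB : ∀ x i, |D1 x i| ≤ B)
    (hp1 : PWCont φ1) (hp2 : PWCont φ2) (hφ1 : ExpDecay β φ1) (hφ2 : ExpDecay β φ2)
    (hn1 : ∫ x in Ioi (0 : ℝ), φ1 x ^ 2 = 1) (hn2 : ∫ x in Ioi (0 : ℝ), φ2 x ^ 2 = 1)
    (hne : (∫ x in Ioi (0 : ℝ), D1 x 1 * φ1 x ^ 2) ≠ ∫ x in Ioi (0 : ℝ), D1 x 2 * φ2 x ^ 2)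
    (hs0 : ∀ g, PWCont g → (∀ x ≥ L, g x = 0) → ∫ x in Ioi (0 : ℝ), φ0 x * g x = 0 →
      ∃ y y', Sol1D (fun x => D0 x 0) lam0 g y y' ∧ ∀ x ≥ L, y x = 0)
    (hs1 : ∀ g, PWCont g → ExpDecay β g → ∫ x in Ioi (0 : ℝ), φ1 x * g x = 0 →
      ∃ y y', Sol1D (fun x => D0 x 1) lam0 g y y' ∧ ExpDecay β y ∧
        ∫ x in Ioi (0 : ℝ), φ1 x * y x = 0)
    (hs2 : ∀ g, PWCont g → ExpDecay β g → ∫ x in Ioi (0 : ℝ), φ2 x * g x = 0 →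
      ∃ y y', Sol1D (fun x => D0 x 2) lam0 g y y' ∧ ExpDecay β y ∧
        ∫ x in Ioi (0 : ℝ), φ2 x * y x = 0)
    (hR : ∀ i, PWCont fun x => R x i) (hRβ : ∀ i, ExpDecay β fun x => R x i)
    (hRL : ∀ x ≥ L, R x 0 = 0) (hRort : ∫ x in Ioi (0 : ℝ), φ0 x * R x 0 = 0) :
    ∃ (lam s : ℝ) (p p' : ℝ → Fin 3 → ℝ),
      (∀ i, Sol1D (fun x => D0 x i) lam0
        (fun x => R x i + (lam - s * D1 x i) * (![0, C1 * φ1 x, C2 * φ2 x] : Fin 3 → ℝ) i)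
        (fun x => p x i) (fun x => p' x i)) ∧
      (∀ i, ExpDecay β fun x => p x i) ∧ (∀ x ≥ L, p x 0 = 0) ∧
      ∫ x in Ioi (0 : ℝ), φ1 x * p x 1 = 0 ∧ ∫ x in Ioi (0 : ℝ), φ2 x * p x 2 = 0 := by
  have horth : ∀ (φ : ℝ → ℝ) (i : Fin 3) (r m c lam s : ℝ), PWCont φ → ExpDecay β φ →
      ∫ x in Ioi (0 : ℝ), φ x ^ 2 = 1 → ∫ x in Ioi (0 : ℝ), φ x * R x i = r →
      ∫ x in Ioi (0 : ℝ), D1 x i * φ x ^ 2 = m → r + c * (lam - s * m) = 0 →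
      PWCont (fun x => R x i + (lam - s * D1 x i) * (c * φ x)) ∧
      ExpDecay β (fun x => R x i + (lam - s * D1 x i) * (c * φ x)) ∧
      ∫ x in Ioi (0 : ℝ), φ x * (R x i + (lam - s * D1 x i) * (c * φ x)) = 0 := by
    intro φ i r m c lam s hp hφ hn hr hm h0
    obtain ⟨Bφ, hBφ⟩ := hφ.bounded hβ
    have hco : PWCont fun x => lam - s * D1 x i :=
      (PWCont.const lam).sub ((PWCont.const s).mul (hD1 i))
    have hcob : ∀ x ∈ Ici (0 : ℝ), |lam - s * D1 x i| ≤ |lam| + |s| * B := fun x _ => by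
      refine (abs_sub _ _).trans (add_le_add le_rfl ?_)
      rw [abs_mul]
      exact mul_le_mul_of_nonneg_left (hB x i) (abs_nonneg _)
    have hq : PWCont fun x => φ x * φ x := hp.mul hp
    have hqβ : ExpDecay β fun x => φ x * φ x := hφ.bdd_mul hBφ
    have i1 : IntegrableOn (fun x => φ x * R x i) (Ioi 0) :=
      ((hRβ i).bdd_mul hBφ).integrableOn hβ (hp.mul (hR i))
    have i2 : IntegrableOn (fun x => φ x ^ 2) (Ioi 0) := by
      simpa [sq] using hqβ.integrableOn hβ hq
    have i3 : IntegrableOn (fun x => D1 x i * φ x ^ 2) (Ioi 0) := by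
      simpa [sq] using (hqβ.bdd_mul fun x _ => hB x i).integrableOn hβ ((hD1 i).mul hq)
    refine ⟨(hR i).add (hco.mul ((PWCont.const c).mul hp)),
      (hRβ i).add ((hφ.const_mul c).bdd_mul hcob), ?_⟩
    have heq : ∀ x, φ x * (R x i + (lam - s * D1 x i) * (c * φ x)) =
        φ x * R x i + (c * lam * φ x ^ 2 - c * s * (D1 x i * φ x ^ 2)) := fun x => by ring
    have i4 : IntegrableOn (fun x => c * lam * φ x ^ 2 - c * s * (D1 x i * φ x ^ 2)) (Ioi 0) :=
      (i2.const_mul _).sub (i3.const_mul _)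
    simp only [heq]
    rw [integral_add i1 i4,
      integral_sub (i2.const_mul _) (i3.const_mul _), integral_const_mul, integral_const_mul,
      hr, hn, hm]
    linarith
  set m1 := ∫ x in Ioi (0 : ℝ), D1 x 1 * φ1 x ^ 2 with hm1
  set m2 := ∫ x in Ioi (0 : ℝ), D1 x 2 * φ2 x ^ 2 with hm2
  set r1 := ∫ x in Ioi (0 : ℝ), φ1 x * R x 1 with hr1
  set r2 := ∫ x in Ioi (0 : ℝ), φ2 x * R x 2 with hr2
  have hm : m1 - m2 ≠ 0 := sub_ne_zero.2 hne
  set s := (r1 / C1 - r2 / C2) / (m1 - m2) with hs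
  set lam := s * m1 - r1 / C1 with hlam
  have e1 : r1 + C1 * (lam - s * m1) = 0 := by
    rw [hlam]
    field_simp
    ring
  have e2 : r2 + C2 * (lam - s * m2) = 0 := by
    have : s * (m1 - m2) = r1 / C1 - r2 / C2 := by rw [hs]; field_simp
    have h : lam - s * m2 = -(r2 / C2) := by rw [hlam]; linarith
    rw [h]
    field_simp
    ring
  obtain ⟨y0, y0', h0, h0L⟩ := hs0 _ (hR 0) hRL hRort
  obtain ⟨a1, b1, c1⟩ := horth φ1 1 r1 m1 C1 lam s hp1 hφ1 hn1 hr1.symm hm1.symm e1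
  obtain ⟨a2, b2, c2⟩ := horth φ2 2 r2 m2 C2 lam s hp2 hφ2 hn2 hr2.symm hm2.symm e2
  obtain ⟨y1, y1', h1, h1β, h1o⟩ := hs1 _ a1 b1 c1
  obtain ⟨y2, y2', h2, h2β, h2o⟩ := hs2 _ a2 b2 c2
  have h0β : ExpDecay β y0 :=
    ExpDecay.of_tail (L := L) (C := 0) (PWCont.of_continuousOn h0.continuousOn)
      fun x hx => by simp [h0L x hx]
  refine ⟨lam, s, fun x => ![y0 x, y1 x, y2 x], fun x => ![y0' x, y1' x, y2' x], ?_, ?_, ?_,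
    ?_, ?_⟩
  · intro i
    fin_cases i
    · simpa using h0
    · simpa using h1
    · simpa using h2
  · intro i
    fin_cases i
    · simpa using h0β
    · simpa using h1β
    · simpa using h2β
  · simpa using h0L
  · simpa using h1o
  · simpa using h2o

section truncatedSource

variable {D1 : ℝ → Fin 3 → ℝ} {F : ℝ → Fin 3 → Fin 3 → ℝ} {S : ℕ → ExpansionTerm} {m n : ℕ}

lemma truncatedSource_pwCont (hD1 : ∀ i, PWCont fun x => D1 x i)
    (hF : ∀ i j, PWCont fun x => F x i j) (hS : ∀ k ≤ n, ∀ i, PWCont fun x => (S k).y x i)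
    (i : Fin 3) : PWCont fun x => truncatedSource D1 F S m n x i := by
  refine (PWCont.sum fun k hk => ?_).sub (PWCont.sum fun j _ => (hF i j).mul (hS n le_rfl j))
  rw [Finset.mem_Icc] at hk
  exact ((PWCont.const _).sub ((PWCont.const _).mul (hD1 i))).mul (hS _ (by omega) i)

lemma truncatedSource_expDecay {A B β : ℝ}
    (hD1 : ∀ x i, |D1 x i| ≤ A) (hF : ∀ x i j, |F x i j| ≤ B)
    (hS : ∀ k ≤ n, ∀ i, ExpDecay β fun x => (S k).y x i)
    (i : Fin 3) : ExpDecay β fun x => truncatedSource D1 F S m n x i := by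
  refine (ExpDecay.sum fun k hk => ?_).sub
    (ExpDecay.sum fun j _ => (hS n le_rfl j).bdd_mul fun x _ => hF x i j)
  rw [Finset.mem_Icc] at hk
  refine (hS _ (by omega) i).bdd_mul (B := |(S k).lam| + |(S k).s| * A) fun x _ => ?_
  refine (abs_sub _ _).trans (add_le_add le_rfl ?_)
  rw [abs_mul]
  exact mul_le_mul_of_nonneg_left (hD1 x i) (abs_nonneg _)

lemma truncatedSource_eq_zero {L : ℝ} (hF : ∀ x ≥ L, F x = 0)
    (hS : ∀ k ≤ n, ∀ x ≥ L, (S k).y x 0 = 0) :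
    ∀ x ≥ L, truncatedSource D1 F S m n x 0 = 0 := by
  intro x hx
  rw [truncatedSource, Finset.sum_eq_zero fun k hk => ?_]
  · simp [hF x hx]
  · rw [Finset.mem_Icc] at hk
    rw [hS _ (by omega) x hx, mul_zero]

end truncatedSource

/-- Theorem 6.1: the recursive construction of a Friedrich–Wintgen BIC as a
power series.  Under assumptions A1, A2, A3:
(1) `y₀ = C1 Φ1 + C2 Φ2` with `C1 = ⟨Φ0,FΦ2⟩`, `C2 = -⟨Φ0,FΦ1⟩` is a real
nonzero linear combination of `Φ1` and `Φ2` with `‖y₀‖ = 1`;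
(2) there exist real sequences `(λ_n)`, `(s_n)`, `(γ_n)` (n ≥ 1);
(3) for each `n ≥ 1` the order-`n` equation `-y_n'' + D0 y_n - λ0 y_n = g_n`,
`y_n'(0) = 0`, `y_n → 0` at `+∞`, with
`g_n = Σ_{i=1}^n (λ_i - s_i D1) y_{n-i} - F y_{n-1}`, has a real solution
`y_n = y_n⁽ᵖ⁾ + γ_n y₀^⊥`, where `y_n⁽ᵖ⁾` is a real particular solution with
`⟨Φ1,y_n⁽ᵖ⁾⟩ = ⟨Φ2,y_n⁽ᵖ⁾⟩ = 0` and `y₀^⊥ = C2 Φ1 - C1 Φ2`. -/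
theorem theorem_6_1_construction
    (L s0 lam0 θ0 : ℝ) (hL : 0 < L) (hlam0 : lam0 ∈ Set.Ioo (0 : ℝ) 1)
    (D0 D1 : ℝ → Fin 3 → ℝ) (F : ℝ → Fin 3 → Fin 3 → ℝ)
    (ED : Finset ℝ)
    (hD0sm : ∀ x ∉ (ED : Set ℝ), ContDiffAt ℝ (⊤ : ℕ∞) D0 x)
    (hD1sm : ∀ x ∉ (ED : Set ℝ), ContDiffAt ℝ (⊤ : ℕ∞) D1 x)
    (hFsm : ∀ x ∉ (ED : Set ℝ), ContDiffAt ℝ (⊤ : ℕ∞) F x)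
    (CB : ℝ)
    (hbdd : ∀ x, (∀ i, |D0 x i| ≤ CB ∧ |D1 x i| ≤ CB) ∧ ∀ i j, |F x i j| ≤ CB)
    (hD0L : ∀ x ≥ L, D0 x = ![0, 1, 1])
    (hD1L : ∀ x ≥ L, D1 x = 0)
    (hFL : ∀ x ≥ L, F x = 0)
    (hFsymm : ∀ x i j, F x i j = F x j i)
    (hFdiag : ∀ x i, F x i i = 0)
    -- assumption A2
    (Is : Set ℝ) (hs0 : s0 ∈ Is)
    (μ1 μ2 : ℝ → ℝ)
    (hμrange : ∀ s ∈ Is, μ1 s ∈ Set.Ioo (0 : ℝ) 1 ∧ μ2 s ∈ Set.Ioo (0 : ℝ) 1)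
    (hfam : ∀ s ∈ Is,
      (∃ ψ ψ' : ℝ → ℝ,
        IsBoundState1D (fun x => D0 x 1 + (s - s0) * D1 x 1) (μ1 s) ψ ψ') ∧
      (∃ ψ ψ' : ℝ → ℝ,
        IsBoundState1D (fun x => D0 x 2 + (s - s0) * D1 x 2) (μ2 s) ψ ψ'))
    (hcross1 : μ1 s0 = lam0) (hcross2 : μ2 s0 = lam0)
    (φ1 φ1' φ2 φ2' : ℝ → ℝ)
    (hφ1 : IsBoundState1D (fun x => D0 x 1) lam0 φ1 φ1')
    (hφ2 : IsBoundState1D (fun x => D0 x 2) lam0 φ2 φ2')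
    (hφ1norm : ∫ x in Set.Ioi (0 : ℝ), (φ1 x) ^ 2 = 1)
    (hφ2norm : ∫ x in Set.Ioi (0 : ℝ), (φ2 x) ^ 2 = 1)
    (hA2 : (∫ x in Set.Ioi (0 : ℝ), D1 x 1 * (φ1 x) ^ 2) ≠
           (∫ x in Set.Ioi (0 : ℝ), D1 x 2 * (φ2 x) ^ 2))
    -- assumption A3
    (φ0 φ0' : ℝ → ℝ)
    (hφ0 : Sol1D (fun x => D0 x 0) lam0 (fun _ => 0) φ0 φ0')
    (hφ0L : ∀ x > L, φ0 x = Real.cos (Real.sqrt lam0 * x + θ0 / 2))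
    (hA3a : (∫ x in Set.Ioi (0 : ℝ), φ0 x * (F x 0 1 * φ1 x)) ≠ 0)
    (hA3b : (∫ x in Set.Ioi (0 : ℝ), φ0 x * (F x 0 2 * φ2 x)) ≠ 0)
    (hA3n : (∫ x in Set.Ioi (0 : ℝ), φ0 x * (F x 0 1 * φ1 x)) ^ 2 +
            (∫ x in Set.Ioi (0 : ℝ), φ0 x * (F x 0 2 * φ2 x)) ^ 2 = 1) :
    ∃ C1 C2 : ℝ,
      C1 = (∫ x in Set.Ioi (0 : ℝ), φ0 x * (F x 0 2 * φ2 x)) ∧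
      C2 = -(∫ x in Set.Ioi (0 : ℝ), φ0 x * (F x 0 1 * φ1 x)) ∧
      -- (1) y₀ is a real nonzero linear combination of Φ1, Φ2 with ‖y₀‖ = 1
      (∃ x ∈ Set.Ici (0 : ℝ), (![0, C1 * φ1 x, C2 * φ2 x] : Fin 3 → ℝ) ≠ 0) ∧
      (∫ x in Set.Ioi (0 : ℝ),
        ∑ i, ((![0, C1 * φ1 x, C2 * φ2 x] : Fin 3 → ℝ) i) ^ 2) = 1 ∧
      -- (2), (3): the recursive construction
      ∃ lamseq sseq gamseq : ℕ → ℝ,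
      ∃ Y Y' Yp Yp' : ℕ → ℝ → Fin 3 → ℝ,
        (∀ x, Y 0 x = ![0, C1 * φ1 x, C2 * φ2 x]) ∧
        ∀ n, 1 ≤ n →
          -- y_n solves the order-n equation with right hand side g_n
          DiagBVPSol D0 lam0
            (fun x i =>
              (∑ k ∈ Finset.Icc 1 n, (lamseq k - sseq k * D1 x i) * Y (n - k) x i) -
              ∑ j, F x i j * Y (n - 1) x j)
            (Y n) (Y' n) ∧
          -- the particular solution y_n⁽ᵖ⁾ solves the same equation
          DiagBVPSol D0 lam0
            (fun x i =>
              (∑ k ∈ Finset.Icc 1 n, (lamseq k - sseq k * D1 x i) * Y (n - k) x i) -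
              ∑ j, F x i j * Y (n - 1) x j)
            (Yp n) (Yp' n) ∧
          -- y_n⁽ᵖ⁾ is orthogonal to Φ1 and Φ2
          (∫ x in Set.Ioi (0 : ℝ), φ1 x * Yp n x 1) = 0 ∧
          (∫ x in Set.Ioi (0 : ℝ), φ2 x * Yp n x 2) = 0 ∧
          -- decomposition y_n = y_n⁽ᵖ⁾ + γ_n y₀^⊥ with y₀^⊥ = C2 Φ1 - C1 Φ2
          (∀ x, Y n x = fun i =>
            Yp n x i + gamseq n * (![0, C2 * φ1 x, -(C1 * φ2 x)] : Fin 3 → ℝ) i) := by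
  have hpwD0 : ∀ i, PWCont fun x => D0 x i := fun i =>
    ⟨⟨ED, fun x _ hx => (continuous_apply i).continuousAt.comp (hD0sm x hx).continuousAt⟩,
      fun _ => ⟨CB, fun x _ => ((hbdd x).1 i).1⟩⟩
  have hpwD1 : ∀ i, PWCont fun x => D1 x i := fun i =>
    ⟨⟨ED, fun x _ hx => (continuous_apply i).continuousAt.comp (hD1sm x hx).continuousAt⟩,
      fun _ => ⟨CB, fun x _ => ((hbdd x).1 i).2⟩⟩
  have hpwF : ∀ i j, PWCont fun x => F x i j := fun i j =>
    ⟨⟨ED, fun x _ hx => (by fun_prop : Continuous fun M : Fin 3 → Fin 3 → ℝ => M i j).continuousAt.comp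
      (hFsm x hx).continuousAt⟩, fun _ => ⟨CB, fun x _ => (hbdd x).2 i j⟩⟩
  obtain ⟨hlam0p, hlam1⟩ := hlam0
  set κ := Real.sqrt (1 - lam0) with hκdef
  have hκ : 0 < κ := Real.sqrt_pos.2 (by linarith)
  have hκlam : lam0 = 1 - κ ^ 2 := by
    rw [hκdef, Real.sq_sqrt (by linarith)]
    ring
  obtain ⟨β, hβ, hβκ⟩ : ∃ β, 0 < β ∧ β < κ := ⟨κ / 2, by linarith, by linarith⟩
  obtain ⟨hφ1β, hs1⟩ := hφ1.solvable (hpwD0 1) (fun x => ((hbdd x).1 1).1) hL.le hβ hβκ hκlam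
    (fun x hx => by simp [hD0L x hx]) hφ1norm
  obtain ⟨hφ2β, hs2⟩ := hφ2.solvable (hpwD0 2) (fun x => ((hbdd x).1 2).1) hL.le hβ hβκ hκlam
    (fun x hx => by simp [hD0L x hx]) hφ2norm
  have hpφ1 := PWCont.of_continuousOn hφ1.1.continuousOn
  have hpφ2 := PWCont.of_continuousOn hφ2.1.continuousOn
  have hpφ0 := PWCont.of_continuousOn hφ0.continuousOn
  have hφ0ne : ∃ x ∈ Ici (0 : ℝ), φ0 x ≠ 0 := by
    by_contra! h
    refine hA3a ((setIntegral_congr_fun measurableSet_Ioi fun x hx => ?_).trans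
      (integral_zero ℝ ℝ))
    simp [h x (Ioi_subset_Ici_self hx)]
  have hs0 : ∀ g, PWCont g → (∀ x ≥ L, g x = 0) → ∫ x in Ioi (0 : ℝ), φ0 x * g x = 0 →
      ∃ y y', Sol1D (fun x => D0 x 0) lam0 g y y' ∧ ∀ x ≥ L, y x = 0 :=
    fun g hg hgL hort => hφ0.exists_vanishing (hpwD0 0) hg hL.le
      (hφ0.weight_pos (hpwD0 0) (fun x => ((hbdd x).1 0).1) hφ0ne) hgL hort
  have hint1 : IntegrableOn (fun x => φ0 x * (F x 0 1 * φ1 x)) (Ioi 0) :=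
    not_imp_comm.1 integral_undef hA3a
  have hint2 : IntegrableOn (fun x => φ0 x * (F x 0 2 * φ2 x)) (Ioi 0) :=
    not_imp_comm.1 integral_undef hA3b
  set a1 := ∫ x in Ioi (0 : ℝ), φ0 x * (F x 0 1 * φ1 x) with ha1
  set a2 := ∫ x in Ioi (0 : ℝ), φ0 x * (F x 0 2 * φ2 x) with ha2
  have hcomb : ∀ u v : ℝ, IntegrableOn (fun x => φ0 x *
      (F x 0 1 * (u * φ1 x) + F x 0 2 * (v * φ2 x))) (Ioi 0) ∧
      ∫ x in Ioi (0 : ℝ), φ0 x * (F x 0 1 * (u * φ1 x) + F x 0 2 * (v * φ2 x)) =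
        u * a1 + v * a2 := by
    intro u v
    have heq : (fun x => φ0 x * (F x 0 1 * (u * φ1 x) + F x 0 2 * (v * φ2 x))) = fun x =>
        u * (φ0 x * (F x 0 1 * φ1 x)) + v * (φ0 x * (F x 0 2 * φ2 x)) := by
      funext x
      ring
    rw [heq]
    refine ⟨(hint1.const_mul u).add (hint2.const_mul v), ?_⟩
    rw [integral_add (hint1.const_mul u) (hint2.const_mul v), integral_const_mul,
      integral_const_mul]
  obtain ⟨C1, hC1⟩ : ∃ C1, C1 = a2 := ⟨_, rfl⟩
  obtain ⟨C2, hC2⟩ : ∃ C2, C2 = -a1 := ⟨_, rfl⟩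
  have hC1ne : C1 ≠ 0 := hC1 ▸ hA3b
  have hC2ne : C2 ≠ 0 := by rw [hC2]; exact neg_ne_zero.2 hA3a
  have hpwY : ∀ u v : ℝ, ∀ i, PWCont fun x => (![0, u * φ1 x, v * φ2 x] : Fin 3 → ℝ) i := by
    intro u v i
    fin_cases i
    · simpa using PWCont.const 0
    · simpa using (PWCont.const u).mul hpφ1
    · simpa using (PWCont.const v).mul hpφ2
  have hβY : ∀ u v : ℝ, ∀ i, ExpDecay β fun x => (![0, u * φ1 x, v * φ2 x] : Fin 3 → ℝ) i := by
    intro u v i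
    fin_cases i
    · simpa using ExpDecay.zero
    · simpa using hφ1β.const_mul u
    · simpa using hφ2β.const_mul v
  have hstep : ∃ S : ℕ → ExpansionTerm, ∀ n,
      (n = 0 → ∀ x, (S n).y x = ![0, C1 * φ1 x, C2 * φ2 x]) ∧
      (∀ m, n = m + 1 →
        DiagBVPSol D0 lam0 (truncatedSource D1 F S (m + 1) m) (S n).y (S n).y' ∧
        DiagBVPSol D0 lam0 (truncatedSource D1 F S (m + 1) m) (S n).p (S n).p' ∧
        ∫ x in Ioi (0 : ℝ), φ1 x * (S n).p x 1 = 0 ∧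
        ∫ x in Ioi (0 : ℝ), φ2 x * (S n).p x 2 = 0 ∧
        ∀ x, (S n).y x = fun i =>
          (S n).p x i + (S n).gam * (![0, C2 * φ1 x, -(C1 * φ2 x)] : Fin 3 → ℝ) i) ∧
      (∀ i, PWCont fun x => (S n).y x i) ∧ (∀ i, ExpDecay β fun x => (S n).y x i) ∧
      (∀ x ≥ L, (S n).y x 0 = 0) ∧
      ∫ x in Ioi (0 : ℝ), φ0 x * truncatedSource D1 F S n n x 0 = 0 := by
    refine exists_seq_of_history _ fun n f hf => ?_
    rcases n with _ | m
    · refine ⟨⟨0, 0, 0, fun x => ![0, C1 * φ1 x, C2 * φ2 x], 0, 0, 0⟩, fun f' _ hf' => ?_⟩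
      simp only [hf']
      refine ⟨fun _ _ => trivial, fun m hm => by omega, hpwY C1 C2, hβY C1 C2, fun x _ => rfl, ?_⟩
      have heq : ∀ x, φ0 x * truncatedSource D1 F f' 0 0 x 0 =
          -(φ0 x * (F x 0 1 * (C1 * φ1 x) + F x 0 2 * (C2 * φ2 x))) := by
        intro x
        simp [truncatedSource, hf', Fin.sum_univ_three]
        ring
      simp only [heq]
      rw [integral_neg, (hcomb C1 C2).2, hC1, hC2]
      ring
    · have hfpw : ∀ k ≤ m, ∀ i, PWCont fun x => (f k).y x i := fun k hk =>
        (hf k (by omega)).2.2.1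
      have hfβ : ∀ k ≤ m, ∀ i, ExpDecay β fun x => (f k).y x i := fun k hk =>
        (hf k (by omega)).2.2.2.1
      have hfL : ∀ k ≤ m, ∀ x ≥ L, (f k).y x 0 = 0 := fun k hk =>
        (hf k (by omega)).2.2.2.2.1
      obtain ⟨lam, s, p, p', hsol, hpβ, hpL, hp1, hp2⟩ := exists_coefficients hβ hC1ne hC2ne
        hpwD1 (fun x i => ((hbdd x).1 i).2) hpφ1 hpφ2 hφ1β hφ2β hφ1norm hφ2norm hA2 hs0 hs1 hs2
        (fun i => truncatedSource_pwCont (m := m) hpwD1 hpwF hfpw i)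
        (fun i => truncatedSource_expDecay (m := m) (fun x i => ((hbdd x).1 i).2)
          (fun x => (hbdd x).2) hfβ i)
        (truncatedSource_eq_zero hFL hfL) (hf m (by omega)).2.2.2.2.2
      have hppw : ∀ i, PWCont fun x => p x i := fun i =>
        PWCont.of_continuousOn (hsol i).continuousOn
      set f₁ := Function.update f (m + 1) ⟨lam, s, 0, p, p', p, p'⟩ with hf₁
      have hf₁eq : f₁ (m + 1) = ⟨lam, s, 0, p, p', p, p'⟩ := Function.update_self ..
      have hf₁ne : ∀ k ≤ m, f₁ k = f k := fun k hk => Function.update_of_ne (by omega) ..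
      have hT : IntegrableOn (fun x => φ0 x * truncatedSource D1 F f₁ (m + 1) (m + 1) x 0)
          (Ioi 0) := by
        have hpw : ∀ k ≤ m + 1, ∀ i, PWCont fun x => (f₁ k).y x i := by
          intro k hk
          rcases Nat.le_succ_iff.1 hk with h | rfl
          · rw [hf₁ne k h]; exact hfpw k h
          · rw [hf₁eq]; exact hppw
        have hvan : ∀ k ≤ m + 1, ∀ x ≥ L, (f₁ k).y x 0 = 0 := by
          intro k hk
          rcases Nat.le_succ_iff.1 hk with h | rfl
          · rw [hf₁ne k h]; exact hfL k h
          · rw [hf₁eq]; exact hpL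
        have hpwT := hpφ0.mul (truncatedSource_pwCont (m := m + 1) hpwD1 hpwF hpw 0)
        exact (ExpDecay.of_tail (β := 1) (L := L) (C := 0) hpwT fun x hx => by
          simp [truncatedSource_eq_zero hFL hvan x hx]).integrableOn one_pos hpwT
      set τ := ∫ x in Ioi (0 : ℝ), φ0 x * truncatedSource D1 F f₁ (m + 1) (m + 1) x 0 with hτ
      refine ⟨⟨lam, s, -τ, fun x i => p x i + -τ * (![0, C2 * φ1 x, -C1 * φ2 x] : Fin 3 → ℝ) i,
        fun x i => p' x i + -τ * (![0, C2 * φ1' x, -C1 * φ2' x] : Fin 3 → ℝ) i, p, p'⟩,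
        fun f' hf' hf'n => ?_⟩
      have hsource : truncatedSource D1 F f' (m + 1) m = fun x i =>
          truncatedSource D1 F f m m x i +
            (lam - s * D1 x i) * (![0, C1 * φ1 x, C2 * φ2 x] : Fin 3 → ℝ) i := by
        funext x i
        have h0 : (f' 0).y x = ![0, C1 * φ1 x, C2 * φ2 x] := by
          rw [hf' 0 (by omega)]
          exact (hf 0 (by omega)).1 rfl x
        have hsum : ∑ k ∈ Finset.Icc 1 m,
            ((f' k).lam - (f' k).s * D1 x i) * (f' (m + 1 - k)).y x i =
            ∑ k ∈ Finset.Icc 1 m, ((f k).lam - (f k).s * D1 x i) * (f (m + 1 - k)).y x i := by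
          refine Finset.sum_congr rfl fun k hk => ?_
          rw [Finset.mem_Icc] at hk
          rw [hf' k (by omega), hf' (m + 1 - k) (by omega)]
        rw [truncatedSource, truncatedSource, Finset.sum_Icc_succ_top (by omega), hsum,
          hf' m (by omega), hf'n, Nat.sub_self, h0]
        ring
      have hnext : ∀ x, φ0 x * truncatedSource D1 F f' (m + 1) (m + 1) x 0 =
          φ0 x * truncatedSource D1 F f₁ (m + 1) (m + 1) x 0 +
            φ0 x * (F x 0 1 * ((τ * C2) * φ1 x) + F x 0 2 * ((-(τ * C1)) * φ2 x)) := by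
        intro x
        have hterm : ∀ k ≤ m + 1, (f' k).lam = (f₁ k).lam ∧ (f' k).s = (f₁ k).s ∧
            (f' k).y x 0 = (f₁ k).y x 0 := by
          intro k hk
          rcases Nat.le_succ_iff.1 hk with h | rfl
          · rw [hf₁ne k h, hf' k (by omega)]
            exact ⟨rfl, rfl, rfl⟩
          · rw [hf₁eq, hf'n]
            exact ⟨rfl, rfl, by simp⟩
        have hsum : ∑ k ∈ Finset.Icc 1 (m + 1),
            ((f' k).lam - (f' k).s * D1 x 0) * (f' (m + 1 + 1 - k)).y x 0 =
            ∑ k ∈ Finset.Icc 1 (m + 1),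
              ((f₁ k).lam - (f₁ k).s * D1 x 0) * (f₁ (m + 1 + 1 - k)).y x 0 := by
          refine Finset.sum_congr rfl fun k hk => ?_
          rw [Finset.mem_Icc] at hk
          rw [(hterm k hk.2).1, (hterm k hk.2).2.1, (hterm (m + 1 + 1 - k) (by omega)).2.2]
        rw [truncatedSource, truncatedSource, hsum, hf₁eq, hf'n]
        simp [Fin.sum_univ_three]
        ring
      have hbound : ∀ i, Sol1D (fun x => D0 x i) lam0 (fun _ => 0)
          (fun x => (![0, C2 * φ1 x, -C1 * φ2 x] : Fin 3 → ℝ) i)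
          (fun x => (![0, C2 * φ1' x, -C1 * φ2' x] : Fin 3 → ℝ) i) := by
        have hzero : ∀ d : ℝ → ℝ, Sol1D d lam0 (fun _ => 0) (fun _ => 0) (fun _ => 0) := fun d =>
          ⟨fun x _ => hasDerivWithinAt_const .., continuousOn_const,
            ⟨∅, fun x _ _ => by simpa using hasDerivAt_const x (0 : ℝ)⟩, rfl⟩
        intro i
        fin_cases i
        · exact hzero _
        · simpa using (hzero _).add_const_mul hφ1.1 C2
        · simpa using (hzero _).add_const_mul hφ2.1 (-C1)
      have hyβ : ∀ i, ExpDecay β fun x =>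
          p x i + -τ * (![0, C2 * φ1 x, -C1 * φ2 x] : Fin 3 → ℝ) i := fun i =>
        (hpβ i).add ((hβY C2 (-C1) i).const_mul (-τ))
      simp only [hf'n]
      refine ⟨fun h => by omega, fun m' hm' => ?_, fun i => (hppw i).add
        ((PWCont.const (-τ)).mul (hpwY C2 (-C1) i)), hyβ, fun x hx => by simp [hpL x hx], ?_⟩
      · obtain rfl : m = m' := by omega
        rw [hsource]
        refine ⟨DiagBVPSol.of_components (fun i => (hsol i).add_const_mul (hbound i) (-τ))
          fun i => (hyβ i).tendsto hβ, DiagBVPSol.of_components hsol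
          fun i => (hpβ i).tendsto hβ, hp1, hp2, fun x => ?_⟩
        simp only [neg_mul]
      · simp only [hnext]
        rw [integral_add hT (hcomb _ _).1, (hcomb _ _).2, ← hτ, hC1, hC2]
        linear_combination (-τ) * hA3n
  obtain ⟨S, hS⟩ := hstep
  have hnormsum : ∀ x, ∑ i, ((![0, C1 * φ1 x, C2 * φ2 x] : Fin 3 → ℝ) i) ^ 2 =
      C1 ^ 2 * φ1 x ^ 2 + C2 ^ 2 * φ2 x ^ 2 := by
    intro x
    simp [Fin.sum_univ_three]
    ring
  refine ⟨C1, C2, hC1, hC2, ?_, ?_, fun n => (S n).lam, fun n => (S n).s, fun n => (S n).gam,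
    fun n => (S n).y, fun n => (S n).y', fun n => (S n).p, fun n => (S n).p',
    (hS 0).1 rfl, fun n hn => ?_⟩
  · obtain ⟨x, hx, hne⟩ := hφ1.2.2
    exact ⟨x, hx, fun h => mul_ne_zero hC1ne hne (congrFun h 1)⟩
  · have h1 : IntegrableOn (fun x => φ1 x ^ 2) (Ioi 0) :=
      not_imp_comm.1 integral_undef (by rw [hφ1norm]; exact one_ne_zero)
    have h2 : IntegrableOn (fun x => φ2 x ^ 2) (Ioi 0) :=
      not_imp_comm.1 integral_undef (by rw [hφ2norm]; exact one_ne_zero)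
    simp only [hnormsum]
    rw [integral_add (h1.const_mul _) (h2.const_mul _), integral_const_mul, integral_const_mul,
      hφ1norm, hφ2norm, hC1, hC2]
    linear_combination hA3n
  · obtain ⟨m, rfl⟩ : ∃ m, n = m + 1 := ⟨n - 1, by omega⟩
    exact (hS (m + 1)).2.1 m rfl

end
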